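/- Let C be a finite set of refinement type constraints and suppose a relational model S satisfies Clone(C), where the refinement variable κ has clones κ¹,…,κⁿ. Then the relational model obtained from S by mapping every clone κⁱ to the intersection ⋂_{i=1}^{n} S(κⁱ) also satisfies Clone(C); consequently any solution of Clone(C) yields a solution of C by assigning each original κ this common intersection. -/

import Mathlib

namespace HMC

/-! ## IMP programs

Base variables and relation variables are natural numbers.  Expressions and
predicates are modelled semantically (an interpretation of the uninterpreted
functions is assumed to have been applied), as functions of the valuation of
the base variables. -/

/-- Primitive IMP commands. -/
inductive Cmd (V : Type*) where
  | assign (x : ℕ) (e : (ℕ → V) → V)            -- x := e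
  | havoc  (x : ℕ)                               -- x := nondet()
  | get    (k : ℕ) (ts : List ℕ)                 -- tuple-get from relation variable k
  | set    (k : ℕ) (xs : List ℕ)                 -- tuple-set into relation variable k
  | assume_ (p : (ℕ → V) → Prop)
  | assert_ (p : (ℕ → V) → Prop)

/-- An instruction is a finite sequence of commands. -/
abbrev Instr (V : Type*) := List (Cmd V)

/-- A program `loop { I₁ [] … [] Iₙ }` is given by its finite list of instructions. -/
abbrev Prog (V : Type*) := List (Instr V)

variable {V : Type*}

/-- Simultaneously update the base variables `ts` with the values `vs`. -/
def updList (b : ℕ → V) : List ℕ → List V → (ℕ → V)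
  | [], _ => b
  | _, [] => b
  | t :: ts, v :: vs => Function.update (updList b ts vs) t v

/-! ### Relational semantics -/

/-- A Relational state: the error state, or a map sending base variables to values
and relation variables to sets of tuples. -/
inductive RState (V : Type*) where
  | err
  | st (base : ℕ → V) (rel : ℕ → Set (List V))

/-- Relational post operator for a single command. -/
def postCmdR : RState V → Cmd V → Set (RState V)
  | .err, _ => {RState.err}
  | .st b r, .assign x e => {RState.st (Function.update b x (e b)) r}
  | .st b r, .havoc x => {σ | ∃ c : V, σ = RState.st (Function.update b x c) r}
  | .st b r, .get k ts =>
      {σ | ∃ vs ∈ r k, vs.length = ts.length ∧ σ = RState.st (updList b ts vs) r}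
  | .st b r, .set k xs => {RState.st b (Function.update r k (insert (xs.map b) (r k)))}
  | .st b r, .assume_ p => {σ | p b ∧ σ = RState.st b r}
  | .st b r, .assert_ p =>
      {σ | (p b ∧ σ = RState.st b r) ∨ (¬ p b ∧ σ = RState.err)}

/-- Relational post operator for an instruction, lifted to sets of states. -/
def postInstrR (S : Set (RState V)) : Instr V → Set (RState V)
  | [] => S
  | c :: I => postInstrR (⋃ σ ∈ S, postCmdR σ c) I

/-- Initial Relational state: relation variables hold the empty set. -/
def initR [Inhabited V] : RState V := RState.st (fun _ => default) (fun _ => ∅)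

/-- Relational states reachable in `m` loop iterations. -/
def reachRN [Inhabited V] (P : Prog V) : ℕ → Set (RState V)
  | 0 => {initR}
  | m + 1 => ⋃ I ∈ P, postInstrR (reachRN P m) I

/-- Relational-reachable states. -/
def reachR [Inhabited V] (P : Prog V) : Set (RState V) := ⋃ m, reachRN P m

/-- A program is Relational-safe if the error state is not Relational-reachable. -/
def RelSafe [Inhabited V] (P : Prog V) : Prop := RState.err ∉ reachR P

/-! ### Imperative semantics -/

/-- An Imperative state: the error state, or a map sending base variables to values
and relation variables to a single tuple or the undefined value `⊥` (`none`). -/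
inductive IState (V : Type*) where
  | err
  | st (base : ℕ → V) (rel : ℕ → Option (List V))

/-- Imperative post operator for a single command. -/
def postCmdI : IState V → Cmd V → Set (IState V)
  | .err, _ => {IState.err}
  | .st b r, .assign x e => {IState.st (Function.update b x (e b)) r}
  | .st b r, .havoc x => {σ | ∃ c : V, σ = IState.st (Function.update b x c) r}
  | .st b r, .get k ts =>
      {σ | ∃ vs, r k = some vs ∧ vs.length = ts.length ∧ σ = IState.st (updList b ts vs) r}
  | .st b r, .set k xs => {IState.st b (Function.update r k (some (xs.map b)))}
  | .st b r, .assume_ p => {σ | p b ∧ σ = IState.st b r}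
  | .st b r, .assert_ p =>
      {σ | (p b ∧ σ = IState.st b r) ∨ (¬ p b ∧ σ = IState.err)}

/-- Imperative post operator for an instruction, lifted to sets of states. -/
def postInstrI (S : Set (IState V)) : Instr V → Set (IState V)
  | [] => S
  | c :: I => postInstrI (⋃ σ ∈ S, postCmdI σ c) I

/-- Initial Imperative state: relation variables are undefined. -/
def initI [Inhabited V] : IState V := IState.st (fun _ => default) (fun _ => none)

/-- Imperative states reachable in `m` loop iterations. -/
def reachIN [Inhabited V] (P : Prog V) : ℕ → Set (IState V)
  | 0 => {initI}
  | m + 1 => ⋃ I ∈ P, postInstrI (reachIN P m) I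

/-- Imperative-reachable states. -/
def reachI [Inhabited V] (P : Prog V) : Set (IState V) := ⋃ m, reachIN P m

/-- A program is Imperative-safe if the error state is not Imperative-reachable. -/
def ImpSafe [Inhabited V] (P : Prog V) : Prop := IState.err ∉ reachI P

/-! ### Read-write-once programs -/

/-- Number of reads of relation variable `k` performed by a command. -/
def Cmd.readsK : Cmd V → ℕ → ℕ
  | .get k _, k' => if k = k' then 1 else 0
  | _, _ => 0

/-- Number of writes to relation variable `k` performed by a command. -/
def Cmd.writesK : Cmd V → ℕ → ℕ
  | .set k _, k' => if k = k' then 1 else 0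
  | _, _ => 0

/-- An instruction is read-write-once if every relation variable is read at most once
and written at most once within it. -/
def RWOnceInstr (I : Instr V) : Prop :=
  ∀ k : ℕ, (I.map (fun c => c.readsK k)).sum ≤ 1 ∧ (I.map (fun c => c.writesK k)).sum ≤ 1

/-- A program is read-write-once if each of its instructions is. -/
def RWOnce (P : Prog V) : Prop := ∀ I ∈ P, RWOnceInstr I

/-! ### Expand: relating the two semantics -/

/-- `Expand` maps a Relational state to the set of corresponding Imperative states. -/
def Expand : RState V → Set (IState V)
  | .err => {IState.err}
  | .st b r =>
      {s | ∃ f : ℕ → Option (List V), s = IState.st b f ∧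
        ∀ k, (∃ vs, f k = some vs ∧ vs ∈ r k) ∨ (f k = none ∧ r k = ∅)}

/-- `Expand` lifted to sets of Relational states. -/
def ExpandS (S : Set (RState V)) : Set (IState V) := ⋃ σ ∈ S, Expand σ

/-! ## Refinement type constraints -/

/-- A refinement: a (semantic) predicate over the program variables and the value
variable ν, or a refinement variable `κ` with pending substitutions `[x₁/y₁]…[xₙ/yₙ]`
(recording the list `y₁,…,yₙ` of substituted program variables). -/
inductive Ref (V : Type*) where
  | pred (p : (ℕ → V) → V → Prop)
  | rvar (k : ℕ) (ys : List ℕ)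

/-- A subtyping constraint `G ⊢ {ν:τ|lhs} <: {ν:τ|rhs}`. -/
structure Constraint (V : Type*) where
  env : List (ℕ × Ref V)
  lhs : Ref V
  rhs : Ref V

/-- A relational model maps each refinement variable `κ` of arity `n+1` to an
`(n+1)`-ary relation, i.e. a set of tuples. -/
abbrev RModel (V : Type*) := ℕ → Set (List V)

/-- The meaning of a refinement under a relational model `S`: a predicate over a
valuation `ρ` of the program variables and the value `v` of ν.  An occurrence
`κ[x₁/y₁]…[xₙ/yₙ]` denotes `∃ t₁…tₙ. S(κ)(v,t₁,…,tₙ) ∧ t₁ = y₁ ∧ … ∧ tₙ = yₙ`. -/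
def Ref.sem (S : RModel V) : Ref V → (ℕ → V) → V → Prop
  | .pred p, ρ, v => p ρ v
  | .rvar k ys, ρ, v => ∃ ts : List V, (v :: ts) ∈ S k ∧ ts = ys.map ρ

/-- The embedding of an environment: each binding `x : T` contributes `⟦T⟧[x/ν]`. -/
def envSem (S : RModel V) (G : List (ℕ × Ref V)) (ρ : ℕ → V) : Prop :=
  ∀ b ∈ G, Ref.sem S b.2 ρ (ρ b.1)

/-- Validity of a subtyping constraint under a relational model:
`⟦G⟧ ⇒ ⟦T₁⟧ ⇒ ⟦T₂⟧` holds for all valuations. -/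
def cvalid (S : RModel V) (c : Constraint V) : Prop :=
  ∀ (ρ : ℕ → V) (v : V), envSem S c.env ρ → Ref.sem S c.lhs ρ v → Ref.sem S c.rhs ρ v

/-- A relational model `S` satisfies (is a solution of) the constraint set `C`. -/
def Satisfies (S : RModel V) (C : List (Constraint V)) : Prop := ∀ c ∈ C, cvalid S c

/-- A constraint set is satisfiable if it admits a relational model solving it. -/
def Satisfiable (C : List (Constraint V)) : Prop := ∃ S : RModel V, Satisfies S C

/-! ## Translation of constraints to IMP programs

Base variables of the translated program: `0` encodes the value variable ν,
`2*i+1` encodes the temporary `tᵢ`, and `2*x+2` encodes the program variable `x`. -/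

/-- Encoding of the program variable `x`. -/
def pv (x : ℕ) : ℕ := 2 * x + 2

/-- Encoding of the temporary `tᵢ`. -/
def tv (i : ℕ) : ℕ := 2 * i + 1

/-- Encoding of the value variable ν. -/
def nuv : ℕ := 0

/-- Lift a refinement predicate to an IMP predicate on the encoded state. -/
def liftP (p : (ℕ → V) → V → Prop) : (ℕ → V) → Prop :=
  fun s => p (fun x => s (pv x)) (s nuv)

/-- "get" translation of a refinement: known refinements become a havoc of ν
followed by an assume; an occurrence `κ[x₁/y₁]…[xₙ/yₙ]` becomes a tuple-get
`(t₀,…,tₙ)` from `κ`, assumes `yᵢ = tᵢ`, and `ν := t₀`. -/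
def getRef : Ref V → Instr V
  | .pred p => [Cmd.havoc nuv, Cmd.assume_ (liftP p)]
  | .rvar k ys =>
      [Cmd.get k ((List.range (ys.length + 1)).map tv)] ++
      (List.range ys.length).map
        (fun i => Cmd.assume_ (fun s => s (pv (ys.getD i 0)) = s (tv (i + 1)))) ++
      [Cmd.assign nuv (fun s => s (tv 0))]

/-- "set" translation of a refinement: a known refinement becomes an assert; an
occurrence `κ[x₁/y₁]…[xₙ/yₙ]` becomes a tuple-set of `(ν,y₁,…,yₙ)` into `κ`. -/
def setRef : Ref V → Instr V
  | .pred p => [Cmd.assert_ (liftP p)]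
  | .rvar k ys => [Cmd.set k (nuv :: ys.map pv)]

/-- Translation of an environment binding `x : T`: get `T`, then `x := ν`. -/
def transBind (b : ℕ × Ref V) : Instr V :=
  getRef b.2 ++ [Cmd.assign (pv b.1) (fun s => s nuv)]

/-- Translation of a subtyping constraint `G ⊢ T₁ <: T₂`: `⟦G⟧; ⟦T₁⟧_get; ⟦T₂⟧_set`. -/
def transC (c : Constraint V) : Instr V :=
  (c.env.map transBind).flatten ++ getRef c.lhs ++ setRef c.rhs

/-- Translation of a constraint set: `loop { ⟦c₁⟧ [] … [] ⟦cₙ⟧ }`. -/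
def trans (C : List (Constraint V)) : Prog V := C.map transC

/-! ## Cloning

The clone `κⁱ` of the refinement variable `κ` is encoded as `Nat.pair κ i`. -/

/-- Number of read occurrences of `κ` in a constraint (environment bindings and LHS). -/
def readsInC (c : Constraint V) (k : ℕ) : ℕ :=
  (c.env.map (fun b =>
      match b.2 with | .rvar k' _ => if k' = k then 1 else 0 | _ => 0)).sum +
  (match c.lhs with | .rvar k' _ => if k' = k then 1 else 0 | _ => 0)

/-- The number of clones of `κ` used for the constraint set `C`: the maximum number
of times `κ` is read within some constraint of `C` (at least one). -/
def nClones (C : List (Constraint V)) (k : ℕ) : ℕ :=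
  max 1 ((C.map (fun c => readsInC c k)).foldr max 0)

/-- Replace the `i`-th read occurrence of each `κ` in the environment by the `i`-th
clone, threading per-variable counters; return the final counters as well. -/
def cloneReads : (ℕ → ℕ) → List (ℕ × Ref V) → ((ℕ → ℕ) × List (ℕ × Ref V))
  | cnt, [] => (cnt, [])
  | cnt, (x, Ref.pred p) :: rest =>
      let r := cloneReads cnt rest
      (r.1, (x, Ref.pred p) :: r.2)
  | cnt, (x, Ref.rvar k ys) :: rest =>
      let r := cloneReads (Function.update cnt k (cnt k + 1)) rest
      (r.1, (x, Ref.rvar (Nat.pair k (cnt k)) ys) :: r.2)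

/-- Clone the read occurrence (if any) on the LHS. -/
def cloneLhs (cnt : ℕ → ℕ) : Ref V → Ref V
  | .pred p => Ref.pred p
  | .rvar k ys => Ref.rvar (Nat.pair k (cnt k)) ys

/-- The cloning procedure: the `i`-th read occurrence of `κ` within any constraint
uses the clone `κⁱ`, and each constraint writing to `κ` on the RHS is replaced by
`n` copies, the `i`-th of which writes to `κⁱ`. -/
def Clone (C : List (Constraint V)) : List (Constraint V) :=
  C.flatMap (fun c =>
    let r := cloneReads (fun _ => 0) c.env
    let env' := r.2
    let lhs' := cloneLhs r.1 c.lhs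
    match c.rhs with
    | Ref.pred p => [⟨env', lhs', Ref.pred p⟩]
    | Ref.rvar k ys =>
        (List.range (nClones C k)).map
          (fun i => ⟨env', lhs', Ref.rvar (Nat.pair k i) ys⟩))

/-! ## The abstraction α -/

/-- The set of tuples stored in relation variable `k` in a Relational state. -/
def relOf : RState V → ℕ → Set (List V)
  | .err, _ => ∅
  | .st _ r, k => r k

/-- `α` maps a set of Relational states to the relational model assigning to each
`κ` the union of the sets stored in the corresponding relation variable across all
non-error states of the set. -/
def alpha (A : Set (RState V)) : RModel V := fun k => ⋃ σ ∈ A, relOf σ k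

/-- Number of read occurrences of `κ` in a single refinement. -/
def Ref.reads : Ref V → ℕ → ℕ
  | .rvar k' _, k => if k' = k then 1 else 0
  | .pred _, _ => 0

/-- Number of read occurrences of `κ` in an environment. -/
def envReads (G : List (ℕ × Ref V)) (k : ℕ) : ℕ := (G.map (fun b => b.2.reads k)).sum

theorem readsInC_eq (c : Constraint V) (k : ℕ) :
    readsInC c k = envReads c.env k + c.lhs.reads k := by
  obtain ⟨G, lhs, rhs⟩ := c
  have hG : ∀ b : ℕ × Ref V,
      (match b.2 with | .rvar k' _ => if k' = k then 1 else 0 | _ => 0) = b.2.reads k := by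
    rintro ⟨x, p | ⟨k', ys⟩⟩ <;> rfl
  cases lhs <;> simp only [readsInC, envReads, hG] <;> rfl

theorem readsInC_le_nClones {C : List (Constraint V)} {c : Constraint V} (hc : c ∈ C) (k : ℕ) :
    readsInC c k ≤ nClones C k := by
  refine le_trans ?_ (le_max_right _ _)
  induction C with
  | nil => simp at hc
  | cons d C ih =>
    rcases List.mem_cons.1 hc with rfl | h
    · exact le_max_left _ _
    · exact (ih h).trans (le_max_right _ _)

theorem envReads_cons (b : ℕ × Ref V) (G : List (ℕ × Ref V)) (k : ℕ) :
    envReads (b :: G) k = b.2.reads k + envReads G k := by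
  simp [envReads]

theorem envSem_cons {S : RModel V} {b : ℕ × Ref V} {G : List (ℕ × Ref V)} {ρ : ℕ → V} :
    envSem S (b :: G) ρ ↔ Ref.sem S b.2 ρ (ρ b.1) ∧ envSem S G ρ := by
  simp only [envSem, List.forall_mem_cons]

theorem cloneReads_fst (G : List (ℕ × Ref V)) (cnt : ℕ → ℕ) (k : ℕ) :
    (cloneReads cnt G).1 k = cnt k + envReads G k := by
  induction G generalizing cnt with
  | nil => simp [cloneReads, envReads]
  | cons b G ih =>
    obtain ⟨x, p | ⟨k', ys⟩⟩ := b
    · simp [cloneReads, ih, envReads_cons, Ref.reads]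
    · by_cases h : k' = k
      · subst h
        simp [cloneReads, ih, envReads_cons, Ref.reads, add_assoc]
      · simp [cloneReads, ih, envReads_cons, Ref.reads, h, Function.update_of_ne (Ne.symm h)]

/-- A model of the original variables contained in all the clones satisfies the cloned
environment whenever it satisfies the original one. -/
theorem envSem_cloneReads_of_subset {S T : RModel V} {n : ℕ → ℕ}
    (hT : ∀ k, ∀ i < n k, T k ⊆ S (Nat.pair k i)) {ρ : ℕ → V} (G : List (ℕ × Ref V))
    (cnt : ℕ → ℕ) (hn : ∀ k, cnt k + envReads G k ≤ n k) (h : envSem T G ρ) :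
    envSem S (cloneReads cnt G).2 ρ := by
  induction G generalizing cnt with
  | nil => simp [cloneReads, envSem]
  | cons b G ih =>
    rw [envSem_cons] at h
    obtain ⟨x, p | ⟨k', ys⟩⟩ := b
    · refine envSem_cons.2 ⟨h.1, ih cnt (fun k => ?_) h.2⟩
      simpa [envReads_cons, Ref.reads] using hn k
    · refine envSem_cons.2 ⟨?_, ih _ (fun k => ?_) h.2⟩
      · obtain ⟨ts, hts, rfl⟩ := h.1
        refine ⟨_, hT k' _ ?_ hts, rfl⟩
        have := hn k'
        simp only [envReads_cons, Ref.reads, if_true] at this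
        omega
      · have := hn k
        by_cases hk : k' = k
        · subst hk
          simp only [envReads_cons, Ref.reads, if_true] at this
          simp only [Function.update_self]
          omega
        · simpa [envReads_cons, Ref.reads, hk, Function.update_of_ne (Ne.symm hk)] using this

theorem sem_cloneLhs_of_subset {S T : RModel V} {n : ℕ → ℕ}
    (hT : ∀ k, ∀ i < n k, T k ⊆ S (Nat.pair k i)) {ρ : ℕ → V} {v : V} (r : Ref V)
    (cnt : ℕ → ℕ) (hn : ∀ k, cnt k + r.reads k ≤ n k) (h : Ref.sem T r ρ v) :
    Ref.sem S (cloneLhs cnt r) ρ v := by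
  cases r with
  | pred p => exact h
  | rvar k ys =>
    obtain ⟨ts, hts, rfl⟩ := h
    refine ⟨_, hT k _ ?_ hts, rfl⟩
    have := hn k
    simp only [Ref.reads, if_true] at this
    omega

theorem sem_rvar_pair (T : RModel V) (k i : ℕ) (ys : List ℕ) (ρ : ℕ → V) (v : V) :
    Ref.sem (fun k' => T k'.unpair.1) (.rvar (Nat.pair k i) ys) ρ v ↔
      Ref.sem T (.rvar k ys) ρ v := by
  simp [Ref.sem]

theorem envSem_cloneReads_unpair (T : RModel V) (G : List (ℕ × Ref V)) (cnt : ℕ → ℕ)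
    (ρ : ℕ → V) :
    envSem (fun k' => T k'.unpair.1) (cloneReads cnt G).2 ρ ↔ envSem T G ρ := by
  induction G generalizing cnt with
  | nil => simp [cloneReads, envSem]
  | cons b G ih =>
    obtain ⟨x, p | ⟨k', ys⟩⟩ := b
    · simp only [cloneReads, envSem_cons, ih, Ref.sem]
    · simp only [cloneReads, envSem_cons, ih, sem_rvar_pair]

theorem sem_cloneLhs_unpair (T : RModel V) (r : Ref V) (cnt : ℕ → ℕ) (ρ : ℕ → V) (v : V) :
    Ref.sem (fun k' => T k'.unpair.1) (cloneLhs cnt r) ρ v ↔ Ref.sem T r ρ v := by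
  cases r with
  | pred p => exact Iff.rfl
  | rvar k ys => exact sem_rvar_pair T k _ ys ρ v

/-- Collapsing all the clones of each variable turns solutions of `C` into solutions of
`Clone C`. -/
theorem satisfies_clone_of_satisfies {T : RModel V} {C : List (Constraint V)}
    (hT : Satisfies T C) : Satisfies (fun k' => T k'.unpair.1) (Clone C) := by
  intro c' hc'
  obtain ⟨⟨G, lhs, rhs⟩, hc, hc'⟩ := List.mem_flatMap.1 hc'
  have hv := hT _ hc
  cases rhs with
  | pred p =>
    obtain rfl := List.mem_singleton.1 hc'
    intro ρ v hG hl
    exact hv ρ v ((envSem_cloneReads_unpair ..).1 hG) ((sem_cloneLhs_unpair ..).1 hl)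
  | rvar k ys =>
    obtain ⟨i, -, rfl⟩ := List.mem_map.1 hc'
    intro ρ v hG hl
    exact (sem_rvar_pair ..).2
      (hv ρ v ((envSem_cloneReads_unpair ..).1 hG) ((sem_cloneLhs_unpair ..).1 hl))

/-- The intersection of the clones in a solution of `Clone C` solves `C`. -/
theorem satisfies_iInter_of_satisfies_clone {S : RModel V} {C : List (Constraint V)}
    (hS : Satisfies S (Clone C)) :
    Satisfies (fun k => ⋂ i ∈ Finset.range (nClones C k), S (Nat.pair k i)) C := by
  rintro ⟨G, lhs, rhs⟩ hc ρ v hG hl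
  have hT : ∀ k, ∀ i < nClones C k,
      (⋂ i ∈ Finset.range (nClones C k), S (Nat.pair k i)) ⊆ S (Nat.pair k i) :=
    fun k i hi => Set.biInter_subset_of_mem (Finset.mem_range.2 hi)
  have hn : ∀ k, envReads G k + lhs.reads k ≤ nClones C k := fun k =>
    (readsInC_eq ⟨G, lhs, rhs⟩ k).symm.trans_le (readsInC_le_nClones hc k)
  have hG' := envSem_cloneReads_of_subset hT G (fun _ => 0)
    (fun k => by have := hn k; omega) hG
  have hl' := sem_cloneLhs_of_subset hT lhs (cloneReads (fun _ => 0) G).1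
    (fun k => by simpa [cloneReads_fst] using hn k) hl
  cases rhs with
  | pred p =>
    exact hS _ (List.mem_flatMap.2 ⟨_, hc, List.mem_singleton.2 rfl⟩) ρ v hG' hl'
  | rvar k ys =>
    refine ⟨_, Set.mem_iInter₂.2 fun i hi => ?_, rfl⟩
    obtain ⟨ts, hts, rfl⟩ := hS _ (List.mem_flatMap.2 ⟨_, hc, List.mem_map.2
      ⟨i, List.mem_range.2 (Finset.mem_range.1 hi), rfl⟩⟩) ρ v hG' hl'
    exact hts

/-- If `S` satisfies `Clone(C)`, then the relational model mapping every clone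
`κⁱ = Nat.pair κ i` to the intersection `⋂_{i < n} S(κⁱ)` of the interpretations of
all the clones of `κ` also satisfies `Clone(C)`; consequently, assigning each
original `κ` this common intersection yields a solution of `C`. -/
theorem clone_intersection_solution
    {V : Type*} (C : List (Constraint V)) (S : RModel V)
    (hS : Satisfies S (Clone C)) :
    Satisfies
        (fun k' => ⋂ i ∈ Finset.range (nClones C k'.unpair.1),
          S (Nat.pair k'.unpair.1 i)) (Clone C) ∧
      Satisfies
        (fun k => ⋂ i ∈ Finset.range (nClones C k), S (Nat.pair k i)) C := by
  have hT := satisfies_iInter_of_satisfies_clone hS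
  exact ⟨satisfies_clone_of_satisfies hT, hT⟩

end HMC
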